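/- Let H = (V, E) be a finite simple graph and let k ≥ 3 be an odd integer. In the min-based reduction instance built from (H, k), under min-AL utilities with any fixed weight w ≥ n^4, the coalition structure Γ is not core-stable if and only if H contains a clique of size k. -/

import Mathlib

open Finset
open scoped Classical

section AHGDefs

variable {N : Type*} [Fintype N] [DecidableEq N]

/-- The set of friends of player `i` inside coalition `C`. -/
noncomputable def friendsIn (G : SimpleGraph N) (C : Finset N) (i : N) : Finset N :=
  C.filter fun j => G.Adj i j

/-- The friend-oriented valuation of coalition `C` by player `i`:
`val_i(C) = n·|F_i ∩ C| − |E_i ∩ C|`. -/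
noncomputable def fval (G : SimpleGraph N) (C : Finset N) (i : N) : ℤ :=
  (Fintype.card N : ℤ) * ((friendsIn G C i).card : ℤ)
    - ((C.filter fun j => ¬ G.Adj i j ∧ j ≠ i).card : ℤ)

/-- Average-based equal-treatment utility. -/
noncomputable def utilAvgEQ (G : SimpleGraph N) (C : Finset N) (i : N) : ℚ :=
  (∑ c ∈ insert i (friendsIn G C i), (fval G C c : ℚ)) /
    ((insert i (friendsIn G C i)).card : ℚ)

/-- Average-based altruistic-treatment utility with weight `w`. -/
noncomputable def utilAvgAL (G : SimpleGraph N) (w : ℚ) (C : Finset N) (i : N) : ℚ :=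
  (fval G C i : ℚ) +
    w * (if (friendsIn G C i).Nonempty then
          (∑ c ∈ friendsIn G C i, (fval G C c : ℚ)) / ((friendsIn G C i).card : ℚ)
         else 0)

/-- Min-based equal-treatment utility. -/
noncomputable def utilMinEQ (G : SimpleGraph N) (C : Finset N) (i : N) : ℤ :=
  (insert i (friendsIn G C i)).inf' (insert_nonempty _ _) (fval G C)

/-- Min-based altruistic-treatment utility with weight `w`. -/
noncomputable def utilMinAL (G : SimpleGraph N) (w : ℤ) (C : Finset N) (i : N) : ℤ :=
  fval G C i +
    w * (if h : (friendsIn G C i).Nonempty then (friendsIn G C i).inf' h (fval G C) else 0)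

/-- A coalition structure (partition of the players), given as the map sending
each player to its coalition. -/
structure CoalitionStructure (N : Type*) [Fintype N] [DecidableEq N] where
  part : N → Finset N
  mem_part : ∀ i, i ∈ part i
  part_eq : ∀ i j, j ∈ part i → part j = part i

/-- A (nonempty) coalition `C` blocks the coalition structure `Γ`. -/
def Blocks {α : Type*} [LT α] (util : Finset N → N → α) (Γ : CoalitionStructure N)
    (C : Finset N) : Prop :=
  C.Nonempty ∧ ∀ i ∈ C, util (Γ.part i) i < util C i

/-- Core stability: no nonempty coalition blocks `Γ`. -/
def CoreStable {α : Type*} [LT α] (util : Finset N → N → α)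
    (Γ : CoalitionStructure N) : Prop :=
  ¬ ∃ C : Finset N, Blocks util Γ C

/-- Cyclic distance between two positions on a cycle of length `k'`. -/
def cycDist (k' : ℕ) (a b : Fin k') : ℕ :=
  min ((a.val + k' - b.val) % k') ((b.val + k' - a.val) % k')

/-- `P` carries an `(r,k')`-circulant gadget of `G`: its `k'` players are arranged
along a cycle of length `k'`, and two players are adjacent iff their distance along
the cycle is at most `r/2` (so each player has `r` friends in the gadget). -/
def IsCirculantGadget (G : SimpleGraph N) (r k' : ℕ) (P : Finset N) : Prop :=
  ∃ f : Fin k' → N, Function.Injective f ∧ Finset.univ.image f = P ∧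
    ∀ a b : Fin k', (G.Adj (f a) (f b) ↔ (a ≠ b ∧ cycDist k' a b ≤ r / 2))

/-- The gadget size `k' = k·(k choose 2) + k + 1` of the min-based reduction. -/
def minK' (k : ℕ) : ℕ := k * Nat.choose k 2 + k + 1

variable {V : Type*} [Fintype V] [DecidableEq V]

/-- The min-based reduction instance built from the graph `H` and an odd `k ≥ 3`:
`G` is the constructed network of friends on the player set `N`; `Pv v`, `Pe e`, and
`Pve v e` are the player sets of the `(k−1,k')`-circulant vertex, edge, and incidence
gadgets with distinguished players `vp v`, `ep e`, and `bp v e` respectively; `Ae e`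
are the `k−3` dummy players of edge `e`, forming a clique. Each `bp v e` is further
adjacent to `vp v` and `ep e`, each dummy in `Ae e` to `ep e` and to both incidence
players of `e`, and there are no other edges. -/
structure MinReduction (H : SimpleGraph V) (k : ℕ) (G : SimpleGraph N)
    (Pv : V → Finset N) (Pe : Sym2 V → Finset N) (Pve : V → Sym2 V → Finset N)
    (Ae : Sym2 V → Finset N) (vp : V → N) (ep : Sym2 V → N) (bp : V → Sym2 V → N) :
    Prop where
  circ_v : ∀ v : V, IsCirculantGadget G (k - 1) (minK' k) (Pv v)
  circ_e : ∀ e ∈ H.edgeSet, IsCirculantGadget G (k - 1) (minK' k) (Pe e)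
  circ_ve : ∀ (v : V), ∀ e ∈ H.edgeSet, v ∈ e →
    IsCirculantGadget G (k - 1) (minK' k) (Pve v e)
  vp_mem : ∀ v : V, vp v ∈ Pv v
  ep_mem : ∀ e ∈ H.edgeSet, ep e ∈ Pe e
  bp_mem : ∀ (v : V), ∀ e ∈ H.edgeSet, v ∈ e → bp v e ∈ Pve v e
  Ae_card : ∀ e ∈ H.edgeSet, (Ae e).card = k - 3
  Ae_clique : ∀ e ∈ H.edgeSet, ∀ a ∈ Ae e, ∀ b ∈ Ae e, a ≠ b → G.Adj a b
  disj_vv : ∀ v w : V, v ≠ w → Disjoint (Pv v) (Pv w)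
  disj_ee : ∀ e ∈ H.edgeSet, ∀ f ∈ H.edgeSet, e ≠ f → Disjoint (Pe e) (Pe f)
  disj_bb : ∀ (v : V), ∀ e ∈ H.edgeSet, v ∈ e → ∀ (w : V), ∀ f ∈ H.edgeSet, w ∈ f →
    (v, e) ≠ (w, f) → Disjoint (Pve v e) (Pve w f)
  disj_aa : ∀ e ∈ H.edgeSet, ∀ f ∈ H.edgeSet, e ≠ f → Disjoint (Ae e) (Ae f)
  disj_v_e : ∀ (v : V), ∀ e ∈ H.edgeSet, Disjoint (Pv v) (Pe e)
  disj_v_b : ∀ (v w : V), ∀ f ∈ H.edgeSet, w ∈ f → Disjoint (Pv v) (Pve w f)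
  disj_v_a : ∀ (v : V), ∀ e ∈ H.edgeSet, Disjoint (Pv v) (Ae e)
  disj_e_b : ∀ e ∈ H.edgeSet, ∀ (w : V), ∀ f ∈ H.edgeSet, w ∈ f →
    Disjoint (Pe e) (Pve w f)
  disj_e_a : ∀ e ∈ H.edgeSet, ∀ f ∈ H.edgeSet, Disjoint (Pe e) (Ae f)
  disj_b_a : ∀ (v : V), ∀ e ∈ H.edgeSet, v ∈ e → ∀ f ∈ H.edgeSet,
    Disjoint (Pve v e) (Ae f)
  cover : ∀ x : N, (∃ v : V, x ∈ Pv v) ∨ (∃ e ∈ H.edgeSet, x ∈ Pe e) ∨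
    (∃ (v : V), ∃ e ∈ H.edgeSet, v ∈ e ∧ x ∈ Pve v e) ∨ (∃ e ∈ H.edgeSet, x ∈ Ae e)
  adj_bv : ∀ (v : V), ∀ e ∈ H.edgeSet, v ∈ e → G.Adj (bp v e) (vp v)
  adj_be : ∀ (v : V), ∀ e ∈ H.edgeSet, v ∈ e → G.Adj (bp v e) (ep e)
  adj_ae : ∀ e ∈ H.edgeSet, ∀ a ∈ Ae e, G.Adj a (ep e)
  adj_ab : ∀ (v : V), ∀ e ∈ H.edgeSet, v ∈ e → ∀ a ∈ Ae e, G.Adj a (bp v e)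
  adj_cases : ∀ x y : N, G.Adj x y →
    (∃ v : V, x ∈ Pv v ∧ y ∈ Pv v) ∨
    (∃ e ∈ H.edgeSet, x ∈ Pe e ∧ y ∈ Pe e) ∨
    (∃ (v : V), ∃ e ∈ H.edgeSet, v ∈ e ∧ x ∈ Pve v e ∧ y ∈ Pve v e) ∨
    (∃ e ∈ H.edgeSet, x ∈ Ae e ∧ y ∈ Ae e) ∨
    (∃ (v : V), ∃ e ∈ H.edgeSet, v ∈ e ∧
      ((x = bp v e ∧ y = vp v) ∨ (y = bp v e ∧ x = vp v))) ∨
    (∃ (v : V), ∃ e ∈ H.edgeSet, v ∈ e ∧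
      ((x = bp v e ∧ y = ep e) ∨ (y = bp v e ∧ x = ep e))) ∨
    (∃ e ∈ H.edgeSet, (x ∈ Ae e ∧ y = ep e) ∨ (y ∈ Ae e ∧ x = ep e)) ∨
    (∃ (v : V), ∃ e ∈ H.edgeSet, v ∈ e ∧
      ((x ∈ Ae e ∧ y = bp v e) ∨ (y ∈ Ae e ∧ x = bp v e)))

/-- `Γ` is the coalition structure of the min-based reduction instance: its coalitions
are exactly the gadget player sets and the dummy sets. -/
def IsMinGamma (H : SimpleGraph V) (Pv : V → Finset N) (Pe : Sym2 V → Finset N)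
    (Pve : V → Sym2 V → Finset N) (Ae : Sym2 V → Finset N)
    (Γ : CoalitionStructure N) : Prop :=
  (∀ v : V, ∀ i ∈ Pv v, Γ.part i = Pv v) ∧
  (∀ e ∈ H.edgeSet, ∀ i ∈ Pe e, Γ.part i = Pe e) ∧
  (∀ (v : V), ∀ e ∈ H.edgeSet, v ∈ e → ∀ i ∈ Pve v e, Γ.part i = Pve v e) ∧
  (∀ e ∈ H.edgeSet, ∀ i ∈ Ae e, Γ.part i = Ae e)
end AHGDefs

section Valuation

lemma mem_friendsIn {N : Type*} {G : SimpleGraph N} {C : Finset N} {i j : N} :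
    j ∈ friendsIn G C i ↔ j ∈ C ∧ G.Adj i j := by
  simp [friendsIn]

variable {N : Type*} [Fintype N] [DecidableEq N] {G : SimpleGraph N} {C : Finset N} {i : N}

lemma fval_eq (hi : i ∈ C) :
    fval G C i = ((Fintype.card N : ℤ) + 1) * (#(friendsIn G C i) : ℤ) - #C + 1 := by
  have h1 := Finset.card_filter_add_card_filter_not (s := C.erase i) (fun j => G.Adj i j)
  have h2 : (C.erase i).filter (fun j => G.Adj i j) = friendsIn G C i := by
    ext j
    simp only [mem_filter, mem_erase, mem_friendsIn]
    exact ⟨fun h => ⟨h.1.2, h.2⟩, fun h => ⟨⟨h.2.ne', h.1⟩, h.2⟩⟩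
  have h3 : (C.erase i).filter (fun j => ¬ G.Adj i j) = C.filter fun j => ¬ G.Adj i j ∧ j ≠ i := by
    ext j
    simp only [mem_filter, mem_erase]
    tauto
  have h4 := Finset.card_erase_add_one hi
  rw [h2, h3] at h1
  rw [← h1] at h4
  have h5 := congrArg (Nat.cast : ℕ → ℤ) h4
  rw [Nat.cast_add, Nat.cast_add, Nat.cast_one] at h5
  unfold fval
  linarith

lemma fval_le_mul_card (G : SimpleGraph N) (C : Finset N) (i : N) :
    fval G C i ≤ (Fintype.card N : ℤ) * #(friendsIn G C i) := by
  unfold fval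
  linarith [Int.natCast_nonneg #(C.filter fun j => ¬ G.Adj i j ∧ j ≠ i)]

lemma fval_le_sq (G : SimpleGraph N) (C : Finset N) (i : N) :
    fval G C i ≤ (Fintype.card N : ℤ) ^ 2 := by
  have h : (#(friendsIn G C i) : ℤ) ≤ Fintype.card N := by exact_mod_cast Finset.card_le_univ _
  calc fval G C i ≤ (Fintype.card N : ℤ) * #(friendsIn G C i) := fval_le_mul_card G C i
    _ ≤ (Fintype.card N : ℤ) * Fintype.card N := by gcongr
    _ = _ := by ring

lemma utilMinAL_le {w B : ℤ} (hw : 0 ≤ w) (hB : 0 ≤ B) (hi : fval G C i ≤ B)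
    (h : ∀ c ∈ C, G.Adj i c → fval G C c ≤ B) : utilMinAL G w C i ≤ B + w * B := by
  unfold utilMinAL
  refine add_le_add hi (mul_le_mul_of_nonneg_left ?_ hw)
  split_ifs with hne
  · obtain ⟨c, hc⟩ := hne
    have hc' := mem_friendsIn.1 hc
    exact (Finset.inf'_le _ hc).trans (h c hc'.1 hc'.2)
  · exact hB

lemma le_utilMinAL {w B : ℤ} (hw : 0 ≤ w) (hne : (friendsIn G C i).Nonempty)
    (hi : B ≤ fval G C i) (h : ∀ c ∈ C, G.Adj i c → B ≤ fval G C c) :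
    B + w * B ≤ utilMinAL G w C i := by
  unfold utilMinAL
  rw [dif_pos hne]
  refine add_le_add hi (mul_le_mul_of_nonneg_left ?_ hw)
  refine Finset.le_inf' _ _ fun c hc => ?_
  rw [mem_friendsIn] at hc
  exact h c hc.1 hc.2

/-- With a large altruism weight, beating the constant profile `B` forces every friend to be
at least as well off as `B`. -/
lemma le_fval_of_lt_utilMinAL {w B : ℤ} (hw : (Fintype.card N : ℤ) ^ 2 ≤ w) (hB : 0 ≤ B)
    (h : B + w * B < utilMinAL G w C i) :
    (friendsIn G C i).Nonempty ∧ ∀ c ∈ C, G.Adj i c → B ≤ fval G C c := by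
  have hsq := fval_le_sq G C i
  have hw0 : 0 ≤ w := le_trans (by positivity) hw
  unfold utilMinAL at h
  split_ifs at h with hne
  · refine ⟨hne, fun c hc hic => ?_⟩
    by_contra! hlt
    have h1 := Finset.inf'_le (fval G C) (mem_friendsIn.2 ⟨hc, hic⟩)
    have h2 : w * (friendsIn G C i).inf' hne (fval G C) ≤ w * (B - 1) :=
      mul_le_mul_of_nonneg_left (by linarith) hw0
    nlinarith
  · exfalso
    rw [Finset.not_nonempty_iff_eq_empty] at hne
    have := fval_le_mul_card G C i
    rw [hne] at this
    simp at this h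
    nlinarith [mul_nonneg hw0 hB]

end Valuation

section Circulant

lemma cycDist_of_le {m : ℕ} {a b : Fin m} (h : a.val ≤ b.val) :
    cycDist m a b = min (a.val + m - b.val) (b.val - a.val) := by
  have ha := a.isLt
  have hb := b.isLt
  unfold cycDist
  rcases h.eq_or_lt with h | h
  · simp [h]
  · rw [Nat.mod_eq_of_lt (show a.val + m - b.val < m by omega),
      show b.val + m - a.val = (b.val - a.val) + m by omega, Nat.add_mod_right,
      Nat.mod_eq_of_lt (by omega)]

lemma cycDist_comm (m : ℕ) (a b : Fin m) : cycDist m a b = cycDist m b a :=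
  min_comm _ _

lemma card_filter_cycDist {m h : ℕ} (hm : 2 * h < m) (a : Fin m) :
    #{b : Fin m | a ≠ b ∧ cycDist m a b ≤ h} = 2 * h := by
  have hcard : #(Finset.Icc 1 h ∪ Finset.Ico (m - h) m) = 2 * h := by
    rw [Finset.card_union_of_disjoint]
    · simp; omega
    · rw [Finset.disjoint_left]
      intro x
      simp
      omega
  rw [← hcard]
  have ha := a.isLt
  refine Finset.card_nbij'
    (fun b => if a.val ≤ b.val then b.val - a.val else b.val + m - a.val)
    (fun d => if hd : a.val + d < m then ⟨a.val + d, hd⟩ else ⟨(a.val + d - m) % m,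
      Nat.mod_lt _ (by omega)⟩) ?_ ?_ ?_ ?_
  · intro b hb
    have hb' := b.isLt
    simp only [coe_filter, mem_univ, true_and, Set.mem_ofPred_eq, ne_eq, Fin.ext_iff] at hb
    simp only [coe_union, coe_Icc, coe_Ico, Set.mem_union, Set.mem_Icc, Set.mem_Ico]
    split_ifs with hab
    · rw [cycDist_of_le hab] at hb
      omega
    · rw [cycDist_comm, cycDist_of_le (by omega)] at hb
      omega
  · intro d hd
    simp only [coe_union, coe_Icc, coe_Ico, Set.mem_union, Set.mem_Icc, Set.mem_Ico] at hd
    simp only [coe_filter, mem_univ, true_and, Set.mem_ofPred_eq, ne_eq, Fin.ext_iff]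
    split_ifs with hab
    · rw [cycDist_of_le (by simp)]
      simp only
      omega
    · have := Nat.mod_eq_of_lt (show a.val + d - m < m by omega)
      simp only [this]
      rw [cycDist_comm, cycDist_of_le (by simp only; omega)]
      simp only
      omega
  · intro b hb
    have hb' := b.isLt
    ext
    simp only
    split_ifs with h1 h2 h2
    · simp only; omega
    · omega
    · omega
    · simp only
      rw [Nat.mod_eq_of_lt (by omega)]
      omega
  · intro d hd
    simp only [coe_union, coe_Icc, coe_Ico, Set.mem_union, Set.mem_Icc, Set.mem_Ico] at hd
    simp only
    split_ifs with h1 h2 h2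
    · simp only; omega
    · simp only at h2; omega
    · simp only at h2
      rw [Nat.mod_eq_of_lt (by omega)] at h2
      omega
    · simp only
      rw [Nat.mod_eq_of_lt (by omega)]
      omega

variable {N : Type*} [DecidableEq N] {G : SimpleGraph N} {P : Finset N} {r m : ℕ}

lemma IsCirculantGadget.card_eq (hP : IsCirculantGadget G r m P) : #P = m := by
  obtain ⟨f, hf, rfl, -⟩ := hP
  rw [Finset.card_image_of_injective _ hf, Finset.card_univ, Fintype.card_fin]

lemma IsCirculantGadget.card_friendsIn {h : ℕ} (hP : IsCirculantGadget G (2 * h) m P)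
    (hm : 2 * h < m) {p : N} (hp : p ∈ P) : #(friendsIn G P p) = 2 * h := by
  obtain ⟨f, hf, rfl, hadj⟩ := hP
  obtain ⟨a, -, rfl⟩ := Finset.mem_image.1 hp
  have hrw : friendsIn G (univ.image f) (f a) =
      Finset.image f {b : Fin m | a ≠ b ∧ cycDist m a b ≤ h} := by
    ext x
    simp only [mem_friendsIn, mem_image, mem_univ, true_and, mem_filter]
    constructor
    · rintro ⟨⟨b, rfl⟩, hb⟩
      have := (hadj a b).1 hb
      exact ⟨b, ⟨this.1, by omega⟩, rfl⟩
    · rintro ⟨b, hb, rfl⟩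
      exact ⟨⟨b, rfl⟩, (hadj a b).2 ⟨hb.1, by omega⟩⟩
  rw [hrw, Finset.card_image_of_injective _ hf, card_filter_cycDist hm]

/-- A circulant gadget stays connected when one player `d` is prevented from spreading. -/
lemma IsCirculantGadget.subset_of_spread (hP : IsCirculantGadget G r m P) (hr : 2 ≤ r)
    {S : Finset N} {d p : N} (hd : d ∈ P) (hp : p ∈ P) (hpS : p ∈ S) (hpd : p ≠ d)
    (hspread : ∀ q ∈ P, q ∈ S → q ≠ d → ∀ q' ∈ P, G.Adj q q' → q' ∈ S) : P ⊆ S := by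
  obtain ⟨f, hf, rfl, hadj⟩ := hP
  obtain ⟨δ, -, rfl⟩ := Finset.mem_image.1 hd
  obtain ⟨a, -, rfl⟩ := Finset.mem_image.1 hp
  have hδ := δ.isLt
  have hm : 0 < m := by omega
  let g : ℕ → Fin m := fun j => ⟨(δ.val + j) % m, Nat.mod_lt _ hm⟩
  have hsurj : ∀ b : Fin m, ∃ j < m, g j = b := by
    intro b
    have hb := b.isLt
    by_cases hle : δ.val ≤ b.val
    · refine ⟨b.val - δ.val, by omega, Fin.ext ?_⟩
      simp only [g]
      rw [show δ.val + (b.val - δ.val) = b.val by omega, Nat.mod_eq_of_lt hb]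
    · refine ⟨b.val + m - δ.val, by omega, Fin.ext ?_⟩
      simp only [g]
      rw [show δ.val + (b.val + m - δ.val) = b.val + m by omega, Nat.add_mod_right,
        Nat.mod_eq_of_lt hb]
  have hne : ∀ j, 0 < j → j < m → f (g j) ≠ f δ := by
    intro j hj hjm h
    have h2 := congrArg Fin.val (hf h)
    simp only [g] at h2
    by_cases hlt : δ.val + j < m
    · rw [Nat.mod_eq_of_lt hlt] at h2
      omega
    · rw [Nat.mod_eq_sub_mod (by omega), Nat.mod_eq_of_lt (by omega)] at h2
      omega
  have hstep : ∀ j, j + 1 < m → G.Adj (f (g j)) (f (g (j + 1))) := by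
    intro j hj
    have hval : ∀ i, i < m → (g i).val = if δ.val + i < m then δ.val + i else δ.val + i - m := by
      intro i hi
      simp only [g]
      split_ifs with hlt
      · exact Nat.mod_eq_of_lt hlt
      · rw [Nat.mod_eq_sub_mod (by omega), Nat.mod_eq_of_lt (by omega)]
    have h1 := hval j (by omega)
    have h2 := hval (j + 1) hj
    rw [hadj]
    refine ⟨fun h => ?_, ?_⟩
    · have := congrArg Fin.val h
      split_ifs at h1 h2 <;> omega
    · by_cases hle : (g j).val ≤ (g (j + 1)).val
      · rw [cycDist_of_le hle]
        split_ifs at h1 h2 <;> omega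
      · rw [cycDist_comm, cycDist_of_le (by omega)]
        split_ifs at h1 h2 <;> omega
  have hmem : ∀ j, f (g j) ∈ Finset.univ.image f := fun j => mem_image_of_mem f (mem_univ _)
  obtain ⟨j₀, hj₀, rfl⟩ := hsurj a
  have hj₀pos : 0 < j₀ := by
    rcases Nat.eq_zero_or_pos j₀ with rfl | h
    · exact absurd (congrArg f (Fin.ext (by simp [g, Nat.mod_eq_of_lt hδ]))) hpd
    · exact h
  have hup : ∀ t, j₀ + t < m → f (g (j₀ + t)) ∈ S := by
    intro t
    induction t with
    | zero => exact fun _ => hpS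
    | succ t ih =>
      intro ht
      exact hspread _ (hmem _) (ih (by omega)) (hne _ (by omega) (by omega)) _ (hmem _)
        (hstep _ ht)
  have hdown : ∀ t ≤ j₀, f (g (j₀ - t)) ∈ S := by
    intro t
    induction t with
    | zero => exact fun _ => hpS
    | succ t ih =>
      intro ht
      have hs := hstep (j₀ - (t + 1)) (by omega)
      rw [show j₀ - (t + 1) + 1 = j₀ - t by omega] at hs
      exact hspread _ (hmem _) (ih (by omega)) (hne _ (by omega) (by omega)) _ (hmem _) hs.symm
  intro x hx
  obtain ⟨b, -, rfl⟩ := Finset.mem_image.1 hx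
  obtain ⟨j, hj, rfl⟩ := hsurj b
  rcases le_total j₀ j with h | h
  · have := hup (j - j₀) (by omega)
    rwa [show j₀ + (j - j₀) = j by omega] at this
  · have := hdown (j₀ - j) (by omega)
    rwa [show j₀ - (j₀ - j) = j by omega] at this

end Circulant

section DoubleCounting

variable {V : Type*} {H : SimpleGraph V} {S : Finset V} {F : Finset (Sym2 V)}

lemma card_filter_mem_sym2 [Fintype V] {e : Sym2 V} (he : e ∈ H.edgeSet) :
    #{v | v ∈ e} = 2 := by
  rw [← Sym2.card_toFinset_of_not_isDiag e (H.not_isDiag_of_mem_edgeSet he)]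
  congr 1
  ext v
  simp

lemma sum_card_filter_mem_eq [Fintype V] (hF : ∀ e ∈ F, e ∈ H.edgeSet)
    (hFS : ∀ e ∈ F, ∀ v ∈ e, v ∈ S) : ∑ v ∈ S, #{e ∈ F | v ∈ e} = 2 * #F := by
  have h := Finset.sum_card_bipartiteAbove_eq_sum_card_bipartiteBelow
    (s := S) (t := F) (fun v e => v ∈ e)
  unfold Finset.bipartiteAbove Finset.bipartiteBelow at h
  rw [h, Finset.sum_congr rfl (g := fun _ => 2), Finset.sum_const, smul_eq_mul, mul_comm]
  intro e he
  rw [← card_filter_mem_sym2 (hF e he)]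
  congr 1
  ext v
  simpa using hFS e he v

lemma card_filter_mem_le (hF : ∀ e ∈ F, e ∈ H.edgeSet) (hFS : ∀ e ∈ F, ∀ v ∈ e, v ∈ S) (v : V) :
    #{e ∈ F | v ∈ e} ≤ #{u ∈ S | H.Adj v u} := by
  refine (Finset.card_le_card fun e he => ?_).trans
    (Finset.card_image_le (f := fun u => s(v, u)) (s := {u ∈ S | H.Adj v u}))
  rw [mem_filter] at he
  obtain ⟨u, rfl⟩ := he.2
  exact mem_image.2 ⟨u, mem_filter.2 ⟨hFS _ he.1 u (Sym2.mem_mk_right v u), hF _ he.1⟩, rfl⟩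

lemma filter_adj_subset_erase (v : V) : {u ∈ S | H.Adj v u} ⊆ S.erase v := by
  intro u hu
  rw [mem_filter] at hu
  exact mem_erase.2 ⟨hu.2.ne', hu.1⟩

lemma two_mul_minK' (h : ℕ) :
    2 * minK' (2 * h + 1) = (2 * h + 1) * ((2 * h + 1) * (2 * h)) + 2 * (2 * h + 1) + 2 := by
  have hc : Nat.choose (2 * h + 1) 2 = (2 * h + 1) * h := by
    rw [Nat.choose_two_right, Nat.add_sub_cancel,
      show (2 * h + 1) * (2 * h) = (2 * h + 1) * h * 2 by ring, Nat.mul_div_cancel _ two_pos]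
  rw [minK', hc]
  ring

/-- Vertices `S` and edges `F` of a subgraph of minimum degree at least `k - 1`, few enough to
fit into the size bound of the reduction, form a clique of size `k = 2 * h + 1`. -/
lemma isNClique_of_card_le [Fintype V] {h : ℕ} (hh : 1 ≤ h) (hF : ∀ e ∈ F, e ∈ H.edgeSet)
    (hFS : ∀ e ∈ F, ∀ v ∈ e, v ∈ S) (hdeg : ∀ v ∈ S, 2 * h ≤ #{e ∈ F | v ∈ e})
    (hS : S.Nonempty) (hcard : #S + (2 * h + 1) * #F ≤ minK' (2 * h + 1)) :
    H.IsNClique (2 * h + 1) S := by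
  have hnb : ∀ v ∈ S, 2 * h ≤ #{u ∈ S | H.Adj v u} := fun v hv =>
    (hdeg v hv).trans (card_filter_mem_le hF hFS v)
  have hlow : 2 * h + 1 ≤ #S := by
    obtain ⟨v, hv⟩ := hS
    have h1 := hnb v hv
    have h2 := Finset.card_le_card (filter_adj_subset_erase (H := H) (S := S) v)
    have h3 := Finset.card_erase_add_one hv
    omega
  have hsum : #S * (2 * h) ≤ 2 * #F := by
    rw [← sum_card_filter_mem_eq hF hFS, ← smul_eq_mul]
    exact Finset.card_nsmul_le_sum _ _ _ hdeg
  have hup : #S ≤ 2 * h + 1 := by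
    by_contra! hlt
    have h1 := two_mul_minK' h
    have h2 : (2 * h + 2) * (2 * h) ≤ 2 * #F := (Nat.mul_le_mul_right _ hlt).trans hsum
    have h3 := Nat.mul_le_mul_left (2 * h + 1) h2
    nlinarith
  refine ⟨fun v hv u hu hvu => ?_, by omega⟩
  have h1 := Finset.eq_of_subset_of_card_le (filter_adj_subset_erase (H := H) (S := S) v) (by
    rw [Finset.card_erase_of_mem hv]
    have := hnb v hv
    omega)
  have h2 : u ∈ {u ∈ S | H.Adj v u} := h1 ▸ mem_erase.2 ⟨hvu.symm, hu⟩
  exact (mem_filter.1 h2).2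

end DoubleCounting

namespace MinReduction

variable {V N : Type*} [DecidableEq N]
  {H : SimpleGraph V} {k : ℕ} {G : SimpleGraph N} {Pv : V → Finset N} {Pe : Sym2 V → Finset N}
  {Pve : V → Sym2 V → Finset N} {Ae : Sym2 V → Finset N} {vp : V → N} {ep : Sym2 V → N}
  {bp : V → Sym2 V → N}

lemma adj_vertex
    (R : MinReduction H k G Pv Pe Pve Ae vp ep bp)
    {v : V} {x y : N} (hx : x ∈ Pv v) (hxy : G.Adj x y) :
    y ∈ Pv v ∨ x = vp v ∧ ∃ e ∈ H.edgeSet, v ∈ e ∧ y = bp v e := by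
  have h1 := R.disj_vv
  have h2 := R.disj_v_e
  have h3 := R.disj_v_b
  have h4 := R.disj_v_a
  have h5 := R.vp_mem
  have h6 := R.ep_mem
  have h7 := R.bp_mem
  simp only [Finset.disjoint_left] at *
  rcases R.adj_cases x y hxy with h | h | h | h | h | h | h | h <;> grind

lemma adj_edge
    (R : MinReduction H k G Pv Pe Pve Ae vp ep bp)
    {e : Sym2 V} (he : e ∈ H.edgeSet) {x y : N} (hx : x ∈ Pe e) (hxy : G.Adj x y) :
    y ∈ Pe e ∨ x = ep e ∧ ((∃ v ∈ e, y = bp v e) ∨ y ∈ Ae e) := by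
  have h1 := R.disj_ee
  have h2 := R.disj_v_e
  have h3 := R.disj_e_b
  have h4 := R.disj_e_a
  have h5 := R.vp_mem
  have h6 := R.ep_mem
  have h7 := R.bp_mem
  simp only [Finset.disjoint_left] at *
  rcases R.adj_cases x y hxy with h | h | h | h | h | h | h | h <;> grind

lemma adj_incidence
    (R : MinReduction H k G Pv Pe Pve Ae vp ep bp)
    {v : V} {e : Sym2 V} (he : e ∈ H.edgeSet) (hv : v ∈ e) {x y : N}
    (hx : x ∈ Pve v e) (hxy : G.Adj x y) :
    y ∈ Pve v e ∨ x = bp v e ∧ (y = vp v ∨ y = ep e ∨ y ∈ Ae e) := by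
  have h1 := R.disj_bb
  have h2 := R.disj_v_b
  have h3 := R.disj_e_b
  have h4 := R.disj_b_a
  have h5 := R.vp_mem
  have h6 := R.ep_mem
  have h7 := R.bp_mem
  simp only [Finset.disjoint_left] at *
  rcases R.adj_cases x y hxy with h | h | h | h | h | h | h | h <;> grind

lemma adj_dummy
    (R : MinReduction H k G Pv Pe Pve Ae vp ep bp)
    {e : Sym2 V} (he : e ∈ H.edgeSet) {x y : N} (hx : x ∈ Ae e) (hxy : G.Adj x y) :
    y ∈ Ae e ∨ y = ep e ∨ ∃ v ∈ e, y = bp v e := by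
  have h1 := R.disj_aa
  have h2 := R.disj_v_a
  have h3 := R.disj_e_a
  have h4 := R.disj_b_a
  have h5 := R.vp_mem
  have h6 := R.ep_mem
  have h7 := R.bp_mem
  simp only [Finset.disjoint_left] at *
  rcases R.adj_cases x y hxy with h | h | h | h | h | h | h | h <;> grind

lemma vp_injective
    (R : MinReduction H k G Pv Pe Pve Ae vp ep bp) : Function.Injective vp := by
  intro v v' h
  by_contra hne
  exact Finset.disjoint_left.1 (R.disj_vv v v' hne) (R.vp_mem v) (h ▸ R.vp_mem v')

lemma bp_inj
    (R : MinReduction H k G Pv Pe Pve Ae vp ep bp)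
    {v v' : V} {e e' : Sym2 V} (he : e ∈ H.edgeSet) (hv : v ∈ e) (he' : e' ∈ H.edgeSet)
    (hv' : v' ∈ e') (h : bp v e = bp v' e') : v = v' ∧ e = e' := by
  by_contra hne
  refine Finset.disjoint_left.1 (R.disj_bb v e he hv v' e' he' hv' fun h' => hne ?_)
    (R.bp_mem v e he hv) (h ▸ R.bp_mem v' e' he' hv')
  exact Prod.ext_iff.1 h'


end MinReduction

/-- A circulant gadget all of whose players other than `d` have friends only inside it. -/
structure IsPendantGadget {N : Type*} [DecidableEq N] (G : SimpleGraph N) (k : ℕ)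
    (P : Finset N) (d : N) : Prop where
  circ : IsCirculantGadget G (k - 1) (minK' k) P
  mem : d ∈ P
  adj : ∀ x ∈ P, x ≠ d → ∀ y, G.Adj x y → y ∈ P

/-- The valuation of every player of a `(k - 1, minK' k)`-circulant gadget among `n` players. -/
def gadgetVal (n k : ℕ) : ℤ := ((n : ℤ) + 1) * ((k : ℤ) - 1) - minK' k + 1

lemma lt_minK' (k : ℕ) : k < minK' k := by
  unfold minK'
  omega

namespace IsPendantGadget

variable {N : Type*} [DecidableEq N] {G : SimpleGraph N} {h : ℕ}
  {P C : Finset N} {d p : N}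

lemma card_friendsIn (hP : IsPendantGadget G (2 * h + 1) P d) (hp : p ∈ P) :
    #(friendsIn G P p) = 2 * h :=
  IsCirculantGadget.card_friendsIn hP.circ (by have := lt_minK' (2 * h + 1); omega) hp

lemma friendsIn_subset (hP : IsPendantGadget G (2 * h + 1) P d) (hp : p ∈ P) (hpd : p ≠ d) :
    friendsIn G C p ⊆ friendsIn G P p := fun x hx => by
  rw [mem_friendsIn] at *
  exact ⟨hP.adj p hp hpd x hx.2, hx.2⟩

variable [Fintype N]

lemma minK'_le_card (hP : IsPendantGadget G (2 * h + 1) P d) :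
    minK' (2 * h + 1) ≤ Fintype.card N :=
  hP.circ.card_eq ▸ Finset.card_le_univ P

lemma fval_eq (hP : IsPendantGadget G (2 * h + 1) P d) (hp : p ∈ P) :
    fval G P p = gadgetVal (Fintype.card N) (2 * h + 1) := by
  rw [_root_.fval_eq hp, hP.card_friendsIn hp, hP.circ.card_eq, gadgetVal]
  push_cast
  ring

end IsPendantGadget

section GadgetVal

variable {N : Type*} [Fintype N] [DecidableEq N] {G : SimpleGraph N} {C : Finset N} {x : N}
  {h : ℕ}

lemma mul_le_gadgetVal {n : ℕ} (hn : minK' (2 * h + 1) ≤ n) :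
    (n : ℤ) * (2 * h - 1) ≤ gadgetVal n (2 * h + 1) := by
  have : (minK' (2 * h + 1) : ℤ) ≤ n := by exact_mod_cast hn
  unfold gadgetVal
  push_cast
  nlinarith

lemma le_card_friendsIn_of_gadgetVal_le (hn : minK' (2 * h + 1) ≤ Fintype.card N) (hx : x ∈ C)
    (hval : gadgetVal (Fintype.card N) (2 * h + 1) ≤ fval G C x) :
    2 * h ≤ #(friendsIn G C x) := by
  by_contra! hlt
  have hn' : (minK' (2 * h + 1) : ℤ) ≤ Fintype.card N := by exact_mod_cast hn
  have hC : (1 : ℤ) ≤ #C := by exact_mod_cast Finset.card_pos.2 ⟨x, hx⟩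
  have hlt' : (#(friendsIn G C x) : ℤ) + 1 ≤ 2 * h := by exact_mod_cast hlt
  rw [fval_eq hx, gadgetVal] at hval
  push_cast at hval
  have := mul_le_mul_of_nonneg_left hlt' (show (0 : ℤ) ≤ (Fintype.card N : ℤ) + 1 by positivity)
  nlinarith

lemma card_le_minK'_of_gadgetVal_le (hx : x ∈ C)
    (hval : gadgetVal (Fintype.card N) (2 * h + 1) ≤ fval G C x)
    (hfr : #(friendsIn G C x) ≤ 2 * h) : #C ≤ minK' (2 * h + 1) := by
  have hfr' : (#(friendsIn G C x) : ℤ) ≤ 2 * h := by exact_mod_cast hfr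
  rw [fval_eq hx, gadgetVal] at hval
  push_cast at hval
  have := mul_le_mul_of_nonneg_left hfr' (show (0 : ℤ) ≤ (Fintype.card N : ℤ) + 1 by positivity)
  have : (#C : ℤ) ≤ minK' (2 * h + 1) := by nlinarith
  exact_mod_cast this

lemma gadgetVal_lt_fval (hx : x ∈ C) (hC : #C < minK' (2 * h + 1))
    (hfr : 2 * h ≤ #(friendsIn G C x)) :
    gadgetVal (Fintype.card N) (2 * h + 1) + 1 ≤ fval G C x := by
  have hfr' : (2 * h : ℤ) ≤ #(friendsIn G C x) := by exact_mod_cast hfr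
  have hC' : (#C : ℤ) + 1 ≤ minK' (2 * h + 1) := by exact_mod_cast hC
  rw [fval_eq hx, gadgetVal]
  push_cast
  have := mul_le_mul_of_nonneg_left hfr' (show (0 : ℤ) ≤ (Fintype.card N : ℤ) + 1 by positivity)
  nlinarith

end GadgetVal

/-- The edge player, the incidence players and the dummies of an edge `e`. -/
noncomputable def edgeStar {V N : Type*} [Fintype V] [DecidableEq N] (Ae : Sym2 V → Finset N)
    (ep : Sym2 V → N) (bp : V → Sym2 V → N) (e : Sym2 V) : Finset N :=
  insert (ep e) (({v | v ∈ e} : Finset V).image (fun v => bp v e) ∪ Ae e)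

namespace MinReduction

section Pendant

variable {V N : Type*} [DecidableEq N]
  {H : SimpleGraph V} {k : ℕ} {G : SimpleGraph N} {Pv : V → Finset N} {Pe : Sym2 V → Finset N}
  {Pve : V → Sym2 V → Finset N} {Ae : Sym2 V → Finset N} {vp : V → N} {ep : Sym2 V → N}
  {bp : V → Sym2 V → N}

lemma pendant_vertex
    (R : MinReduction H k G Pv Pe Pve Ae vp ep bp) (v : V) : IsPendantGadget G k (Pv v) (vp v) where
  circ := R.circ_v v
  mem := R.vp_mem v
  adj _ hx hne _ hxy := (R.adj_vertex hx hxy).resolve_right fun h => hne h.1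

lemma pendant_edge
    (R : MinReduction H k G Pv Pe Pve Ae vp ep bp)
    {e : Sym2 V} (he : e ∈ H.edgeSet) : IsPendantGadget G k (Pe e) (ep e) where
  circ := R.circ_e e he
  mem := R.ep_mem e he
  adj _ hx hne _ hxy := (R.adj_edge he hx hxy).resolve_right fun h => hne h.1

lemma pendant_incidence
    (R : MinReduction H k G Pv Pe Pve Ae vp ep bp)
    {v : V} {e : Sym2 V} (he : e ∈ H.edgeSet) (hv : v ∈ e) :
    IsPendantGadget G k (Pve v e) (bp v e) where
  circ := R.circ_ve v e he hv
  mem := R.bp_mem v e he hv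
  adj _ hx hne _ hxy := (R.adj_incidence he hv hx hxy).resolve_right fun h => hne h.1

variable [Fintype V]

lemma card_edgeStar
    (R : MinReduction H k G Pv Pe Pve Ae vp ep bp) (hk : 3 ≤ k) {e : Sym2 V} (he : e ∈ H.edgeSet) :
    #(edgeStar Ae ep bp e) = k := by
  rw [edgeStar, Finset.card_insert_of_notMem, Finset.card_union_of_disjoint,
    Finset.card_image_of_injOn, card_filter_mem_sym2 he, R.Ae_card e he]
  · omega
  · intro v hv v' hv' heq
    simp only [coe_filter, mem_univ, true_and, Set.mem_ofPred_eq] at hv hv'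
    exact (R.bp_inj he hv he hv' heq).1
  · rw [Finset.disjoint_left]
    intro x hx hxA
    simp only [mem_image, mem_filter, mem_univ, true_and] at hx
    obtain ⟨v, hv, rfl⟩ := hx
    exact Finset.disjoint_left.1 (R.disj_b_a v e he hv e he) (R.bp_mem v e he hv) hxA
  · simp only [mem_union, mem_image, mem_filter, mem_univ, true_and, not_or]
    refine ⟨?_, fun h => Finset.disjoint_left.1 (R.disj_e_a e he e he) (R.ep_mem e he) h⟩
    rintro ⟨v, hv, heq⟩
    exact Finset.disjoint_left.1 (R.disj_e_b e he v e he hv) (R.ep_mem e he)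
      (heq ▸ R.bp_mem v e he hv)

lemma mem_edgeStar {e : Sym2 V} {x : N} :
    x ∈ edgeStar Ae ep bp e ↔ x = ep e ∨ (∃ v ∈ e, x = bp v e) ∨ x ∈ Ae e := by
  simp [edgeStar, eq_comm]

lemma adj_edgePlayer
    (R : MinReduction H k G Pv Pe Pve Ae vp ep bp)
    {e : Sym2 V} (he : e ∈ H.edgeSet) {x : N} (hx : x ∈ edgeStar Ae ep bp e)
    (hne : x ≠ ep e) : G.Adj (ep e) x := by
  rcases mem_edgeStar.1 hx with h | ⟨v, hv, rfl⟩ | h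
  · exact absurd h hne
  · exact (R.adj_be v e he hv).symm
  · exact (R.adj_ae e he x h).symm

lemma adj_dummy_iff
    (R : MinReduction H k G Pv Pe Pve Ae vp ep bp)
    {e : Sym2 V} (he : e ∈ H.edgeSet) {a x : N} (ha : a ∈ Ae e) :
    G.Adj a x ↔ x ∈ (edgeStar Ae ep bp e).erase a := by
  rw [mem_erase, mem_edgeStar]
  constructor
  · intro h
    exact ⟨h.ne', or_rotate.1 (R.adj_dummy he ha h)⟩
  · rintro ⟨hne, rfl | ⟨v, hv, rfl⟩ | h⟩
    · exact R.adj_ae e he a ha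
    · exact R.adj_ab v e he hv a ha
    · exact R.Ae_clique e he a ha x h hne.symm

lemma friendsIn_dummy_subset
    (R : MinReduction H k G Pv Pe Pve Ae vp ep bp)
    {e : Sym2 V} (he : e ∈ H.edgeSet) {a : N} (ha : a ∈ Ae e)
    (C : Finset N) : friendsIn G C a ⊆ (edgeStar Ae ep bp e).erase a := fun _ hx =>
  (R.adj_dummy_iff he ha).1 (mem_friendsIn.1 hx).2

end Pendant

section Disjointness

variable {V N : Type*} [Fintype V] [DecidableEq N]
  {H : SimpleGraph V} {k : ℕ} {G : SimpleGraph N} {Pv : V → Finset N} {Pe : Sym2 V → Finset N}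
  {Pve : V → Sym2 V → Finset N} {Ae : Sym2 V → Finset N} {vp : V → N} {ep : Sym2 V → N}
  {bp : V → Sym2 V → N}

lemma disjoint_edgeStar
    (R : MinReduction H k G Pv Pe Pve Ae vp ep bp)
    {e f : Sym2 V} (he : e ∈ H.edgeSet) (hf : f ∈ H.edgeSet) (hne : e ≠ f) :
    Disjoint (edgeStar Ae ep bp e) (edgeStar Ae ep bp f) := by
  have h1 := R.disj_ee
  have h2 := R.disj_aa
  have h3 := R.disj_e_b
  have h4 := R.disj_e_a
  have h5 := R.disj_b_a
  have h6 := R.ep_mem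
  have h7 := R.bp_mem
  have h8 := R.disj_bb
  simp only [Finset.disjoint_left] at *
  intro x hx hx'
  rw [mem_edgeStar] at hx hx'
  grind

lemma vp_notMem_edgeStar
    (R : MinReduction H k G Pv Pe Pve Ae vp ep bp) {v : V} {e : Sym2 V} (he : e ∈ H.edgeSet) :
    vp v ∉ edgeStar Ae ep bp e := by
  have h1 := R.disj_v_e
  have h2 := R.disj_v_b
  have h3 := R.disj_v_a
  have h4 := R.vp_mem
  have h5 := R.ep_mem
  have h6 := R.bp_mem
  simp only [Finset.disjoint_left] at *
  rw [mem_edgeStar]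
  grind

end Disjointness

section CoreStability

variable {V N : Type*} [Fintype N] [DecidableEq N]
  {H : SimpleGraph V} {h : ℕ} {G : SimpleGraph N} {Pv : V → Finset N} {Pe : Sym2 V → Finset N}
  {Pve : V → Sym2 V → Finset N} {Ae : Sym2 V → Finset N} {vp : V → N} {ep : Sym2 V → N}
  {bp : V → Sym2 V → N} {w : ℤ} {Γ : CoalitionStructure N} {C : Finset N}

lemma exists_pendant_or_dummy
    (R : MinReduction H (2 * h + 1) G Pv Pe Pve Ae vp ep bp)
    (hΓ : IsMinGamma H Pv Pe Pve Ae Γ) (x : N) :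
    (∃ d, IsPendantGadget G (2 * h + 1) (Γ.part x) d ∧
      ((∃ v, d = vp v) ∨ ∃ e ∈ H.edgeSet, d = ep e ∨ ∃ v ∈ e, d = bp v e)) ∨
    ∃ e ∈ H.edgeSet, x ∈ Ae e ∧ Γ.part x = Ae e := by
  obtain ⟨h1, h2, h3, h4⟩ := hΓ
  rcases R.cover x with ⟨v, hx⟩ | ⟨e, he, hx⟩ | ⟨v, e, he, hv, hx⟩ | ⟨e, he, hx⟩
  · exact Or.inl ⟨vp v, h1 v x hx ▸ R.pendant_vertex v, Or.inl ⟨v, rfl⟩⟩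
  · exact Or.inl ⟨ep e, h2 e he x hx ▸ R.pendant_edge he, Or.inr ⟨e, he, Or.inl rfl⟩⟩
  · exact Or.inl ⟨bp v e, h3 v e he hv x hx ▸ R.pendant_incidence he hv,
      Or.inr ⟨e, he, Or.inr ⟨v, hv, rfl⟩⟩⟩
  · exact Or.inr ⟨e, he, hx, h4 e he x hx⟩

lemma minK'_le_card
    (R : MinReduction H (2 * h + 1) G Pv Pe Pve Ae vp ep bp)
    (hΓ : IsMinGamma H Pv Pe Pve Ae Γ) (x : N) :
    minK' (2 * h + 1) ≤ Fintype.card N := by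
  rcases R.exists_pendant_or_dummy hΓ x with ⟨d, hd, -⟩ | ⟨e, he, -⟩
  · exact hd.minK'_le_card
  · exact (R.pendant_edge he).minK'_le_card

lemma gadgetVal_nonneg
    (R : MinReduction H (2 * h + 1) G Pv Pe Pve Ae vp ep bp)
    (hh : 1 ≤ h) (hΓ : IsMinGamma H Pv Pe Pve Ae Γ) (x : N) :
    0 ≤ gadgetVal (Fintype.card N) (2 * h + 1) := by
  have h1 : (1 : ℤ) ≤ h := by exact_mod_cast hh
  exact le_trans (mul_nonneg (by positivity) (by linarith))
    (mul_le_gadgetVal (R.minK'_le_card hΓ x))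

/-- Players outside the dummy sets only join blocking coalitions in which all their friends are
at least as well off as in a gadget. -/
lemma pendant_of_blocks
    (R : MinReduction H (2 * h + 1) G Pv Pe Pve Ae vp ep bp)
    (hh : 1 ≤ h) (hΓ : IsMinGamma H Pv Pe Pve Ae Γ)
    (hw : (Fintype.card N : ℤ) ^ 2 ≤ w) (hC : Blocks (utilMinAL G w) Γ C) {x d : N} (hx : x ∈ C)
    (hd : IsPendantGadget G (2 * h + 1) (Γ.part x) d) :
    (friendsIn G C x).Nonempty ∧
      ∀ c ∈ C, G.Adj x c → gadgetVal (Fintype.card N) (2 * h + 1) ≤ fval G C c := by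
  refine le_fval_of_lt_utilMinAL hw (R.gadgetVal_nonneg hh hΓ x)
    (lt_of_le_of_lt ?_ (hC.2 x hx))
  have hne : (friendsIn G (Γ.part x) x).Nonempty := by
    rw [← Finset.card_pos, hd.card_friendsIn (Γ.mem_part x)]
    omega
  exact le_utilMinAL (le_trans (by positivity) hw) hne (hd.fval_eq (Γ.mem_part x)).ge
    fun c hc _ => (hd.fval_eq hc).ge

lemma part_edgePlayer
    (R : MinReduction H (2 * h + 1) G Pv Pe Pve Ae vp ep bp)
    (hΓ : IsMinGamma H Pv Pe Pve Ae Γ) {e : Sym2 V} (he : e ∈ H.edgeSet) :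
    Γ.part (ep e) = Pe e :=
  hΓ.2.1 e he _ (R.ep_mem e he)

lemma part_incidencePlayer
    (R : MinReduction H (2 * h + 1) G Pv Pe Pve Ae vp ep bp)
    (hΓ : IsMinGamma H Pv Pe Pve Ae Γ) {v : V} {e : Sym2 V}
    (he : e ∈ H.edgeSet) (hv : v ∈ e) : Γ.part (bp v e) = Pve v e :=
  hΓ.2.2.1 v e he hv _ (R.bp_mem v e he hv)

variable [Fintype V]

/-- A dummy in a blocking coalition has a friend there that is not a dummy. -/
lemma exists_friend_of_dummy_mem
    (R : MinReduction H (2 * h + 1) G Pv Pe Pve Ae vp ep bp)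
    (hh : 1 ≤ h) (hΓ : IsMinGamma H Pv Pe Pve Ae Γ) (hw : 0 ≤ w)
    (hC : Blocks (utilMinAL G w) Γ C) {e : Sym2 V} (he : e ∈ H.edgeSet) {a : N} (ha : a ∈ Ae e)
    (haC : a ∈ C) : ep e ∈ C ∨ ∃ v ∈ e, bp v e ∈ C := by
  by_contra! hcon
  have hcard := R.Ae_card e he
  have hpos : 0 < #(Ae e) := Finset.card_pos.2 ⟨a, ha⟩
  have hh2 : 2 ≤ h := by omega
  have hh2' : (2 : ℤ) ≤ h := by exact_mod_cast hh2
  have hfr : ∀ c ∈ Ae e, ∀ x ∈ C, G.Adj c x → x ∈ (Ae e).erase c := by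
    intro c hc x hx hcx
    have h1 := (R.adj_dummy_iff he hc).1 hcx
    rw [mem_erase, mem_edgeStar] at h1
    rw [mem_erase]
    refine ⟨h1.1, ?_⟩
    rcases h1.2 with rfl | ⟨v, hv, rfl⟩ | h2
    · exact absurd hx hcon.1
    · exact absurd hx (hcon.2 v hv)
    · exact h2
  have hle : ∀ c ∈ Ae e, fval G C c ≤ (Fintype.card N : ℤ) * (2 * h - 3) := by
    intro c hc
    refine (fval_le_mul_card G C c).trans (mul_le_mul_of_nonneg_left ?_ (by positivity))
    have h1 : friendsIn G C c ⊆ (Ae e).erase c := fun x hx =>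
      hfr c hc x (mem_friendsIn.1 hx).1 (mem_friendsIn.1 hx).2
    have h2 := Finset.card_le_card h1
    rw [Finset.card_erase_of_mem hc] at h2
    have h3 : #(friendsIn G C c) + 3 ≤ 2 * h := by omega
    have h4 : (#(friendsIn G C c) : ℤ) + 3 ≤ 2 * h := by exact_mod_cast h3
    linarith
  have heq : ∀ c ∈ Ae e, friendsIn G (Ae e) c = (Ae e).erase c := by
    intro c hc
    ext x
    rw [mem_friendsIn, mem_erase]
    exact ⟨fun hx => ⟨hx.2.ne', hx.1⟩, fun hx => ⟨hx.2, R.Ae_clique e he c hc x hx.2 hx.1.symm⟩⟩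
  have hge : ∀ c ∈ Ae e, (Fintype.card N : ℤ) * (2 * h - 3) ≤ fval G (Ae e) c := by
    intro c hc
    have h1 : #(Ae e) + 2 = 2 * h := by omega
    have h2 : #((Ae e).erase c) + 3 = 2 * h := by
      rw [Finset.card_erase_of_mem hc]
      omega
    have h1' : (#(Ae e) : ℤ) = 2 * h - 2 := by
      rw [eq_sub_iff_add_eq]
      exact_mod_cast h1
    have h2' : (#((Ae e).erase c) : ℤ) = 2 * h - 3 := by
      rw [eq_sub_iff_add_eq]
      exact_mod_cast h2
    rw [fval_eq hc, heq c hc, h1', h2']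
    linarith
  have hlt := hC.2 a haC
  rw [hΓ.2.2.2 e he a ha] at hlt
  have hne : (friendsIn G (Ae e) a).Nonempty := by
    rw [heq a ha, ← Finset.card_pos, Finset.card_erase_of_mem ha]
    omega
  have hB : (0 : ℤ) ≤ (Fintype.card N : ℤ) * (2 * h - 3) :=
    mul_nonneg (by positivity) (by linarith)
  exact absurd hlt (not_lt.2 ((utilMinAL_le hw hB (hle a ha) fun c hc hac =>
    hle c (mem_of_mem_erase (hfr a ha c hc hac))).trans
      (le_utilMinAL hw hne (hge a ha) fun c hc _ => hge c hc)))

lemma le_fval_of_dummy_mem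
    (R : MinReduction H (2 * h + 1) G Pv Pe Pve Ae vp ep bp)
    (hh : 1 ≤ h) (hΓ : IsMinGamma H Pv Pe Pve Ae Γ)
    (hw : (Fintype.card N : ℤ) ^ 2 ≤ w) (hC : Blocks (utilMinAL G w) Γ C) {e : Sym2 V}
    (he : e ∈ H.edgeSet) {a : N} (ha : a ∈ Ae e) (haC : a ∈ C) :
    gadgetVal (Fintype.card N) (2 * h + 1) ≤ fval G C a := by
  rcases R.exists_friend_of_dummy_mem hh hΓ (le_trans (by positivity) hw) hC he ha haC with
    hmem | ⟨v, hv, hmem⟩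
  · exact (R.pendant_of_blocks hh hΓ hw hC hmem
      (R.part_edgePlayer hΓ he ▸ R.pendant_edge he)).2 a haC (R.adj_ae e he a ha).symm
  · exact (R.pendant_of_blocks hh hΓ hw hC hmem
      (R.part_incidencePlayer hΓ he hv ▸ R.pendant_incidence he hv)).2 a haC
        (R.adj_ab v e he hv a ha).symm

lemma edgeStar_subset_of_dummy_mem
    (R : MinReduction H (2 * h + 1) G Pv Pe Pve Ae vp ep bp)
    (hh : 1 ≤ h) (hΓ : IsMinGamma H Pv Pe Pve Ae Γ)
    (hw : (Fintype.card N : ℤ) ^ 2 ≤ w) (hC : Blocks (utilMinAL G w) Γ C) {e : Sym2 V}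
    (he : e ∈ H.edgeSet) {a : N} (ha : a ∈ Ae e) (haC : a ∈ C) : edgeStar Ae ep bp e ⊆ C := by
  have h1 := le_card_friendsIn_of_gadgetVal_le (R.minK'_le_card hΓ a) haC
    (R.le_fval_of_dummy_mem hh hΓ hw hC he ha haC)
  have ha' : a ∈ edgeStar Ae ep bp e := mem_edgeStar.2 (Or.inr (Or.inr ha))
  have h2 := Finset.eq_of_subset_of_card_le (R.friendsIn_dummy_subset he ha C) (by
    rw [Finset.card_erase_of_mem ha', R.card_edgeStar (by omega) he]
    omega)
  intro x hx
  rcases eq_or_ne x a with rfl | hne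
  · exact haC
  · have : x ∈ friendsIn G C a := h2 ▸ mem_erase.2 ⟨hne, hx⟩
    exact (mem_friendsIn.1 this).1

/-- Every player of a blocking coalition is at least as well off as in a gadget. -/
lemma gadgetVal_le_fval
    (R : MinReduction H (2 * h + 1) G Pv Pe Pve Ae vp ep bp)
    (hh : 1 ≤ h) (hΓ : IsMinGamma H Pv Pe Pve Ae Γ)
    (hw : (Fintype.card N : ℤ) ^ 2 ≤ w) (hC : Blocks (utilMinAL G w) Γ C) {x : N} (hx : x ∈ C) :
    gadgetVal (Fintype.card N) (2 * h + 1) ≤ fval G C x := by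
  rcases R.exists_pendant_or_dummy hΓ x with ⟨d, hd, -⟩ | ⟨e, he, hxA, -⟩
  swap
  · exact R.le_fval_of_dummy_mem hh hΓ hw hC he hxA hx
  obtain ⟨y, hy⟩ := (R.pendant_of_blocks hh hΓ hw hC hx hd).1
  obtain ⟨hyC, hxy⟩ := mem_friendsIn.1 hy
  rcases R.exists_pendant_or_dummy hΓ y with ⟨d', hd', -⟩ | ⟨e, he, hyA, -⟩
  · exact (R.pendant_of_blocks hh hΓ hw hC hyC hd').2 x hx hxy.symm
  have hsub := R.edgeStar_subset_of_dummy_mem hh hΓ hw hC he hyA hyC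
  rcases R.adj_dummy he hyA hxy.symm with hxA | rfl | ⟨v, hv, rfl⟩
  · exact R.le_fval_of_dummy_mem hh hΓ hw hC he hxA hx
  · obtain ⟨v, hv⟩ : ∃ v, v ∈ e := ⟨_, Sym2.out_fst_mem e⟩
    have hb : bp v e ∈ C := hsub (mem_edgeStar.2 (Or.inr (Or.inl ⟨v, hv, rfl⟩)))
    exact (R.pendant_of_blocks hh hΓ hw hC hb
      (R.part_incidencePlayer hΓ he hv ▸ R.pendant_incidence he hv)).2 _ hx (R.adj_be v e he hv)
  · have hb : ep e ∈ C := hsub (mem_edgeStar.2 (Or.inl rfl))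
    exact (R.pendant_of_blocks hh hΓ hw hC hb
      (R.part_edgePlayer hΓ he ▸ R.pendant_edge he)).2 _ hx (R.adj_be v e he hv).symm

lemma le_card_friendsIn
    (R : MinReduction H (2 * h + 1) G Pv Pe Pve Ae vp ep bp)
    (hh : 1 ≤ h) (hΓ : IsMinGamma H Pv Pe Pve Ae Γ)
    (hw : (Fintype.card N : ℤ) ^ 2 ≤ w) (hC : Blocks (utilMinAL G w) Γ C) {x : N} (hx : x ∈ C) :
    2 * h ≤ #(friendsIn G C x) :=
  le_card_friendsIn_of_gadgetVal_le (R.minK'_le_card hΓ x) hx (R.gadgetVal_le_fval hh hΓ hw hC hx)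

/-- A blocking coalition contains no gadget player besides the distinguished one. -/
lemma eq_of_mem_pendant
    (R : MinReduction H (2 * h + 1) G Pv Pe Pve Ae vp ep bp)
    (hh : 1 ≤ h) (hΓ : IsMinGamma H Pv Pe Pve Ae Γ)
    (hw : (Fintype.card N : ℤ) ^ 2 ≤ w) (hC : Blocks (utilMinAL G w) Γ C) {x d : N} (hx : x ∈ C)
    (hd : IsPendantGadget G (2 * h + 1) (Γ.part x) d) : x = d := by
  by_contra hne
  have heq : ∀ q ∈ Γ.part x, q ∈ C → q ≠ d → friendsIn G C q = friendsIn G (Γ.part x) q := by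
    intro q hq hqC hqd
    refine Finset.eq_of_subset_of_card_le (hd.friendsIn_subset hq hqd) ?_
    rw [hd.card_friendsIn hq]
    exact R.le_card_friendsIn hh hΓ hw hC hqC
  have hsub : Γ.part x ⊆ C := by
    refine hd.circ.subset_of_spread (by omega) hd.mem (Γ.mem_part x) hx hne ?_
    intro q hq hqC hqd q' hq' hqq'
    have : q' ∈ friendsIn G C q := heq q hq hqC hqd ▸ mem_friendsIn.2 ⟨hq', hqq'⟩
    exact (mem_friendsIn.1 this).1
  have hcard := card_le_minK'_of_gadgetVal_le hx (R.gadgetVal_le_fval hh hΓ hw hC hx)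
    (heq x (Γ.mem_part x) hx hne ▸ (hd.card_friendsIn (Γ.mem_part x)).le)
  have hCeq : Γ.part x = C :=
    Finset.eq_of_subset_of_card_le hsub (hcard.trans hd.circ.card_eq.ge)
  exact absurd (hC.2 x hx) (by rw [hCeq]; exact lt_irrefl _)

lemma card_le_of_edgePlayer_mem
    (R : MinReduction H (2 * h + 1) G Pv Pe Pve Ae vp ep bp)
    (hh : 1 ≤ h) (hΓ : IsMinGamma H Pv Pe Pve Ae Γ)
    (hw : (Fintype.card N : ℤ) ^ 2 ≤ w) (hC : Blocks (utilMinAL G w) Γ C) {e : Sym2 V}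
    (he : e ∈ H.edgeSet) (heC : ep e ∈ C) :
    edgeStar Ae ep bp e ⊆ C ∧ #C ≤ minK' (2 * h + 1) := by
  have hmem : ep e ∈ edgeStar Ae ep bp e := mem_edgeStar.2 (Or.inl rfl)
  have hsub : friendsIn G C (ep e) ⊆ (edgeStar Ae ep bp e).erase (ep e) := by
    intro x hx
    obtain ⟨hxC, hadj⟩ := mem_friendsIn.1 hx
    refine mem_erase.2 ⟨hadj.ne', mem_edgeStar.2 ?_⟩
    rcases R.adj_edge he (R.ep_mem e he) hadj with hxP | ⟨-, hv | hA⟩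
    · exact Or.inl (R.eq_of_mem_pendant hh hΓ hw hC hxC
        (hΓ.2.1 e he x hxP ▸ R.pendant_edge he))
    · exact Or.inr (Or.inl hv)
    · exact Or.inr (Or.inr hA)
  have hcard : #((edgeStar Ae ep bp e).erase (ep e)) = 2 * h := by
    rw [Finset.card_erase_of_mem hmem, R.card_edgeStar (by omega) he]
    omega
  have heq := Finset.eq_of_subset_of_card_le hsub
    (hcard ▸ R.le_card_friendsIn hh hΓ hw hC heC)
  refine ⟨fun x hx => ?_, card_le_minK'_of_gadgetVal_le heC
    (R.gadgetVal_le_fval hh hΓ hw hC heC) (by rw [heq, hcard])⟩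
  rcases eq_or_ne x (ep e) with rfl | hne
  · exact heC
  · have : x ∈ friendsIn G C (ep e) := heq ▸ mem_erase.2 ⟨hne, hx⟩
    exact (mem_friendsIn.1 this).1

lemma mem_of_incidencePlayer_mem
    (R : MinReduction H (2 * h + 1) G Pv Pe Pve Ae vp ep bp)
    (hh : 1 ≤ h) (hΓ : IsMinGamma H Pv Pe Pve Ae Γ)
    (hw : (Fintype.card N : ℤ) ^ 2 ≤ w) (hC : Blocks (utilMinAL G w) Γ C) {v : V} {e : Sym2 V}
    (he : e ∈ H.edgeSet) (hv : v ∈ e) (hb : bp v e ∈ C) : vp v ∈ C ∧ ep e ∈ C := by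
  have hsub : friendsIn G C (bp v e) ⊆ {vp v, ep e} ∪ Ae e := by
    intro x hx
    obtain ⟨hxC, hadj⟩ := mem_friendsIn.1 hx
    simp only [mem_union, mem_insert, mem_singleton]
    rcases R.adj_incidence he hv (R.bp_mem v e he hv) hadj with hxP | ⟨-, h1 | h1 | h1⟩
    · exact absurd (R.eq_of_mem_pendant hh hΓ hw hC hxC
        (hΓ.2.2.1 v e he hv x hxP ▸ R.pendant_incidence he hv)) hadj.ne'
    · exact Or.inl (Or.inl h1)
    · exact Or.inl (Or.inr h1)
    · exact Or.inr h1
  have hcard : #({vp v, ep e} ∪ Ae e) ≤ 2 * h := by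
    have h1 := Finset.card_union_le {vp v, ep e} (Ae e)
    have h2 := Finset.card_le_two (a := vp v) (b := ep e)
    have h3 := R.Ae_card e he
    omega
  have heq := Finset.eq_of_subset_of_card_le hsub
    (hcard.trans (R.le_card_friendsIn hh hΓ hw hC hb))
  have h1 : vp v ∈ friendsIn G C (bp v e) := heq ▸ by simp
  have h2 : ep e ∈ friendsIn G C (bp v e) := heq ▸ by simp
  exact ⟨(mem_friendsIn.1 h1).1, (mem_friendsIn.1 h2).1⟩

lemma exists_isNClique_of_blocks
    (R : MinReduction H (2 * h + 1) G Pv Pe Pve Ae vp ep bp)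
    (hh : 1 ≤ h) (hΓ : IsMinGamma H Pv Pe Pve Ae Γ)
    (hw : (Fintype.card N : ℤ) ^ 2 ≤ w) (hC : Blocks (utilMinAL G w) Γ C) :
    ∃ K : Finset V, H.IsNClique (2 * h + 1) K := by
  have hstar : ∀ e ∈ H.edgeSet, ep e ∈ C → ∀ v ∈ e, vp v ∈ C := fun e he heC v hv =>
    (R.mem_of_incidencePlayer_mem hh hΓ hw hC he hv
      ((R.card_le_of_edgePlayer_mem hh hΓ hw hC he heC).1
        (mem_edgeStar.2 (Or.inr (Or.inl ⟨v, hv, rfl⟩))))).1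
  set S : Finset V := {v | vp v ∈ C} with hSdef
  set F : Finset (Sym2 V) := {e | e ∈ H.edgeSet ∧ ep e ∈ C} with hFdef
  have hS : ∀ v, v ∈ S ↔ vp v ∈ C := by simp [hSdef]
  have hF : ∀ e, e ∈ F ↔ e ∈ H.edgeSet ∧ ep e ∈ C := by simp [hFdef]
  have hdeg : ∀ v ∈ S, 2 * h ≤ #{e ∈ F | v ∈ e} := by
    intro v hv
    rw [hS] at hv
    refine (R.le_card_friendsIn hh hΓ hw hC hv).trans ((Finset.card_le_card fun x hx => ?_).trans
      (Finset.card_image_le (f := fun e => bp v e) (s := {e ∈ F | v ∈ e})))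
    obtain ⟨hxC, hadj⟩ := mem_friendsIn.1 hx
    rcases R.adj_vertex (R.vp_mem v) hadj with hxP | ⟨-, e, he, hve, rfl⟩
    · exact absurd (R.eq_of_mem_pendant hh hΓ hw hC hxC (hΓ.1 v x hxP ▸ R.pendant_vertex v))
        hadj.ne'
    · exact mem_image.2 ⟨e, mem_filter.2 ⟨(hF e).2
        ⟨he, (R.mem_of_incidencePlayer_mem hh hΓ hw hC he hve hxC).2⟩, hve⟩, rfl⟩
  have hedge : ∀ e ∈ H.edgeSet, ep e ∈ C → S.Nonempty := fun e he heC =>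
    ⟨_, (hS _).2 (hstar e he heC _ (Sym2.out_fst_mem e))⟩
  have hSne : S.Nonempty := by
    obtain ⟨x, hx⟩ := hC.1
    rcases R.exists_pendant_or_dummy hΓ x with ⟨d, hd, hd'⟩ | ⟨e, he, hxA, -⟩
    · obtain rfl := R.eq_of_mem_pendant hh hΓ hw hC hx hd
      rcases hd' with ⟨v, rfl⟩ | ⟨e, he, rfl | ⟨v, hv, rfl⟩⟩
      · exact ⟨v, (hS v).2 hx⟩
      · exact hedge e he hx
      · exact ⟨v, (hS v).2 (R.mem_of_incidencePlayer_mem hh hΓ hw hC he hv hx).1⟩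
    · exact hedge e he (R.edgeStar_subset_of_dummy_mem hh hΓ hw hC he hxA hx
        (mem_edgeStar.2 (Or.inl rfl)))
  have hCcard : #C ≤ minK' (2 * h + 1) := by
    obtain ⟨v, hv⟩ := hSne
    obtain ⟨e, he⟩ := Finset.card_pos.1 (lt_of_lt_of_le (by omega) (hdeg v hv))
    have he' := (hF e).1 (mem_filter.1 he).1
    exact (R.card_le_of_edgePlayer_mem hh hΓ hw hC he'.1 he'.2).2
  refine ⟨S, isNClique_of_card_le hh (fun e he => ((hF e).1 he).1)
    (fun e he v hv => (hS v).2 (hstar e ((hF e).1 he).1 ((hF e).1 he).2 v hv)) hdeg hSne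
    (le_trans ?_ hCcard)⟩
  have hsubC : S.image vp ∪ F.biUnion (edgeStar Ae ep bp) ⊆ C := by
    refine Finset.union_subset ?_ (Finset.biUnion_subset.2 fun e he =>
      (R.card_le_of_edgePlayer_mem hh hΓ hw hC ((hF e).1 he).1 ((hF e).1 he).2).1)
    intro x hx
    obtain ⟨v, hv, rfl⟩ := mem_image.1 hx
    exact (hS v).1 hv
  refine le_trans (Eq.le ?_) (Finset.card_le_card hsubC)
  rw [Finset.card_union_of_disjoint, Finset.card_image_of_injective _ R.vp_injective,
    Finset.card_biUnion, Finset.sum_congr rfl (g := fun _ => 2 * h + 1), Finset.sum_const,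
    smul_eq_mul, mul_comm]
  · exact fun e he => R.card_edgeStar (by omega) ((hF e).1 he).1
  · intro e he f hf hne
    exact R.disjoint_edgeStar ((hF e).1 he).1 ((hF f).1 hf).1 hne
  · rw [Finset.disjoint_left]
    intro x hx hx'
    obtain ⟨v, hv, rfl⟩ := mem_image.1 hx
    obtain ⟨e, he, hxe⟩ := mem_biUnion.1 hx'
    exact R.vp_notMem_edgeStar ((hF e).1 he).1 hxe

/-- The coalition of the distinguished players and dummies belonging to a clique blocks. -/
lemma blocks_of_isNClique
    (R : MinReduction H (2 * h + 1) G Pv Pe Pve Ae vp ep bp)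
    (hh : 1 ≤ h) (hΓ : IsMinGamma H Pv Pe Pve Ae Γ) (hw : 0 ≤ w)
    {K : Finset V} (hK : H.IsNClique (2 * h + 1) K) :
    ∃ C, Blocks (utilMinAL G w) Γ C := by
  set F : Finset (Sym2 V) := {e | e ∈ H.edgeSet ∧ ∀ v ∈ e, v ∈ K} with hFdef
  have hF : ∀ e, e ∈ F ↔ e ∈ H.edgeSet ∧ ∀ v ∈ e, v ∈ K := by simp [hFdef]
  have hmF : ∀ v ∈ K, ∀ u ∈ K, u ≠ v → s(v, u) ∈ F := by
    intro v hv u hu huv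
    refine (hF _).2 ⟨hK.1 hv hu huv.symm, fun x hx => ?_⟩
    rcases Sym2.mem_iff.1 hx with rfl | rfl <;> assumption
  have hFcard : 2 * #F ≤ (2 * h + 1) * (2 * h) := by
    rw [← sum_card_filter_mem_eq (S := K) (fun e he => ((hF e).1 he).1)
      (fun e he => ((hF e).1 he).2), ← hK.2, ← smul_eq_mul]
    refine Finset.sum_le_card_nsmul _ _ _ fun v hv => ?_
    refine (card_filter_mem_le (H := H) (fun e he => ((hF e).1 he).1)
      (fun e he => ((hF e).1 he).2) v).trans ?_
    have h1 := Finset.card_le_card (filter_adj_subset_erase (H := H) (S := K) v)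
    have h2 := Finset.card_erase_add_one hv
    have h3 := hK.2
    omega
  set C : Finset N := K.image vp ∪ F.biUnion (edgeStar Ae ep bp) with hCdef
  have hmemC : ∀ x, x ∈ C ↔ (∃ v ∈ K, vp v = x) ∨ ∃ e ∈ F, x ∈ edgeStar Ae ep bp e := by
    simp [hCdef]
  have hCcard : #C < minK' (2 * h + 1) := by
    have h1 : #C ≤ #K + #F * (2 * h + 1) := (Finset.card_union_le _ _).trans
      (add_le_add Finset.card_image_le (Finset.card_biUnion_le_card_mul _ _ _
        fun e he => (R.card_edgeStar (by omega) ((hF e).1 he).1).le))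
    have h2 := two_mul_minK' h
    have h3 := Nat.mul_le_mul_left (2 * h + 1) hFcard
    rw [hK.2] at h1
    nlinarith
  have hstarC : ∀ e ∈ F, edgeStar Ae ep bp e ⊆ C := fun e he x hx =>
    (hmemC x).2 (Or.inr ⟨e, he, hx⟩)
  have hstarErase : ∀ e ∈ F, ∀ x ∈ edgeStar Ae ep bp e,
      #((edgeStar Ae ep bp e).erase x) = 2 * h := by
    intro e he x hx
    rw [Finset.card_erase_of_mem hx, R.card_edgeStar (by omega) ((hF e).1 he).1]
    omega
  have hdeg : ∀ x ∈ C, 2 * h ≤ #(friendsIn G C x) := by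
    intro x hx
    rcases (hmemC x).1 hx with ⟨v, hv, rfl⟩ | ⟨e, he, hxe⟩
    · have h1 : #((K.erase v).image fun u => bp v s(v, u)) = 2 * h := by
        rw [Finset.card_image_of_injOn, Finset.card_erase_of_mem hv, hK.2]
        · omega
        · intro u hu u' hu' heq
          simp only [coe_erase, Set.mem_sdiff, mem_coe, Set.mem_singleton_iff] at hu hu'
          have h2 := (R.bp_inj ((hF _).1 (hmF v hv u hu.1 hu.2)).1 (Sym2.mem_mk_left v u)
            ((hF _).1 (hmF v hv u' hu'.1 hu'.2)).1 (Sym2.mem_mk_left v u') heq).2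
          exact Sym2.congr_right.1 h2
      rw [← h1]
      refine Finset.card_le_card fun y hy => ?_
      obtain ⟨u, hu, rfl⟩ := mem_image.1 hy
      obtain ⟨huv, huK⟩ := mem_erase.1 hu
      have huF := hmF v hv u huK huv
      exact mem_friendsIn.2 ⟨hstarC _ huF (mem_edgeStar.2 (Or.inr (Or.inl
        ⟨v, Sym2.mem_mk_left v u, rfl⟩))),
        (R.adj_bv v _ ((hF _).1 huF).1 (Sym2.mem_mk_left v u)).symm⟩
    · obtain ⟨heH, heK⟩ := (hF e).1 he
      rcases mem_edgeStar.1 hxe with rfl | ⟨v, hv, rfl⟩ | hxA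
      · rw [← hstarErase e he _ hxe]
        refine Finset.card_le_card fun y hy => mem_friendsIn.2 ?_
        obtain ⟨hne, hy⟩ := mem_erase.1 hy
        exact ⟨hstarC e he hy, R.adj_edgePlayer heH hy hne⟩
      · have h1 : 2 * h ≤ #(insert (vp v) (insert (ep e) (Ae e))) := by
          rw [Finset.card_insert_of_notMem, Finset.card_insert_of_notMem, R.Ae_card e heH]
          · omega
          · exact fun h => Finset.disjoint_left.1 (R.disj_e_a e heH e heH) (R.ep_mem e heH) h
          · refine fun h => R.vp_notMem_edgeStar heH (v := v) (mem_edgeStar.2 ?_)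
            rcases mem_insert.1 h with h | h
            · exact Or.inl h
            · exact Or.inr (Or.inr h)
        refine h1.trans (Finset.card_le_card fun y hy => mem_friendsIn.2 ?_)
        rcases mem_insert.1 hy with rfl | hy
        · exact ⟨(hmemC _).2 (Or.inl ⟨v, heK v hv, rfl⟩), R.adj_bv v e heH hv⟩
        rcases mem_insert.1 hy with rfl | hy
        · exact ⟨hstarC e he (mem_edgeStar.2 (Or.inl rfl)), R.adj_be v e heH hv⟩
        · exact ⟨hstarC e he (mem_edgeStar.2 (Or.inr (Or.inr hy))),
            (R.adj_ab v e heH hv y hy).symm⟩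
      · rw [← hstarErase e he _ hxe]
        refine Finset.card_le_card fun y hy => mem_friendsIn.2
          ⟨hstarC e he (mem_of_mem_erase hy), (R.adj_dummy_iff heH hxA).2 hy⟩
  have hval : ∀ x ∈ C, gadgetVal (Fintype.card N) (2 * h + 1) + 1 ≤ fval G C x := fun x hx =>
    gadgetVal_lt_fval hx hCcard (hdeg x hx)
  refine ⟨C, ?_, fun x hx => ?_⟩
  · obtain ⟨v, hv⟩ := Finset.card_pos.1 (by rw [hK.2]; omega : 0 < #K)
    exact ⟨vp v, (hmemC _).2 (Or.inl ⟨v, hv, rfl⟩)⟩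
  have hpart : ∀ c ∈ Γ.part x,
      fval G (Γ.part x) c ≤ gadgetVal (Fintype.card N) (2 * h + 1) := by
    intro c hc
    rcases R.exists_pendant_or_dummy hΓ x with ⟨d, hd, -⟩ | ⟨e, he, -, hA⟩
    · exact (hd.fval_eq hc).le
    · refine (fval_le_mul_card G _ c).trans (le_trans (mul_le_mul_of_nonneg_left ?_
        (by positivity)) (mul_le_gadgetVal (R.minK'_le_card hΓ x)))
      have h1 : #(friendsIn G (Γ.part x) c) ≤ #(Γ.part x) := Finset.card_filter_le _ _
      rw [hA, R.Ae_card e he] at h1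
      have h2 : #(friendsIn G (Γ.part x) c) + 1 ≤ 2 * h := by rw [hA]; omega
      have h3 : (#(friendsIn G (Γ.part x) c) : ℤ) + 1 ≤ 2 * h := by exact_mod_cast h2
      linarith
  refine lt_of_le_of_lt (utilMinAL_le hw (R.gadgetVal_nonneg hh hΓ x) (hpart x (Γ.mem_part x))
    fun c hc _ => hpart c hc) (lt_of_lt_of_le ?_ (le_utilMinAL hw
      (Finset.card_pos.1 (lt_of_lt_of_le (by omega) (hdeg x hx))) (hval x hx)
      fun c hc _ => hval c hc))
  nlinarith

end CoreStability

end MinReduction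

/-- In the min-based reduction instance built from a graph `H` and an odd `k ≥ 3`,
under min-AL utilities with any fixed weight `w ≥ n^4`, the coalition structure `Γ`
is not core-stable iff `H` contains a clique of size `k`. -/
theorem minAL_not_coreStable_iff_clique {V N : Type*} [Fintype V] [DecidableEq V]
    [Fintype N] [DecidableEq N]
    (H : SimpleGraph V) (k : ℕ) (hk : 3 ≤ k) (hodd : Odd k)
    (G : SimpleGraph N) (Pv : V → Finset N) (Pe : Sym2 V → Finset N)
    (Pve : V → Sym2 V → Finset N) (Ae : Sym2 V → Finset N)
    (vp : V → N) (ep : Sym2 V → N) (bp : V → Sym2 V → N)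
    (R : MinReduction H k G Pv Pe Pve Ae vp ep bp)
    (w : ℤ) (hw : (Fintype.card N : ℤ) ^ 4 ≤ w)
    (Γ : CoalitionStructure N) (hΓ : IsMinGamma H Pv Pe Pve Ae Γ) :
    ¬ CoreStable (utilMinAL G w) Γ ↔ ∃ K : Finset V, H.IsNClique k K := by
  obtain ⟨h, rfl⟩ := hodd
  have hh : 1 ≤ h := by omega
  rw [CoreStable, not_not]
  constructor
  · rintro ⟨C, hC⟩
    obtain ⟨x, hx⟩ := hC.1
    have hn : 1 ≤ Fintype.card N := Fintype.card_pos_iff.2 ⟨x⟩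
    have hn' : (1 : ℤ) ≤ Fintype.card N := by exact_mod_cast hn
    exact R.exists_isNClique_of_blocks hh hΓ
      ((pow_le_pow_right₀ hn' (by norm_num)).trans hw) hC
  · rintro ⟨K, hK⟩
    exact R.blocks_of_isNClique hh hΓ (le_trans (by positivity) hw) hK
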